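/- For every probability distribution q on [L]×[L] and every ε > 0 there exist p ∈ 𝔓_>([L]) and invertible channels W_1, W_2 ∈ 𝒲([L],[L]) such that ‖(W_1⊗W_2) p^{(2)} − q‖_1 ≤ ε. In other words, the set FR(L,2,L) of outputs of two-channel dependent component systems with strictly positive input distribution and full-range channels is dense in 𝔓([L]^2) with respect to the 1-norm. -/

import Mathlib

open scoped BigOperators

/-- `p` is a probability distribution on `Fin L`. -/
def probDist {L : ℕ} (p : Fin L → ℝ) : Prop :=
  (∀ i, 0 ≤ p i) ∧ ∑ i, p i = 1

/-- `p` is a probability distribution on `Fin L` with all entries strictly positive. -/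
def probPos {L : ℕ} (p : Fin L → ℝ) : Prop :=
  (∀ i, 0 < p i) ∧ ∑ i, p i = 1

/-- `p^{(K)}`: the function on `[L]^K` equal to `p i` on the constant tuple `(i,…,i)`
and `0` elsewhere. -/
def diagEmbed {L : ℕ} (p : Fin L → ℝ) (K : ℕ) : (Fin K → Fin L) → ℝ :=
  fun y => ∑ i, if (∀ k, y k = i) then p i else 0

/-- The action of `X_1 ⊗ … ⊗ X_K` on functions `[L]^K → ℝ`. -/
def tensorAct {L L' K : ℕ} (X : Fin K → Matrix (Fin L') (Fin L) ℝ)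
    (v : (Fin K → Fin L) → ℝ) : (Fin K → Fin L') → ℝ :=
  fun y => ∑ x : Fin K → Fin L, v x * ∏ k, X k (y k) (x k)

/-- A channel from `[L]` to `[L']`: an `L' × L` column-stochastic matrix. -/
def isChannel {L L' : ℕ} (W : Matrix (Fin L') (Fin L) ℝ) : Prop :=
  (∀ i j, 0 ≤ W i j) ∧ ∀ j, ∑ i, W i j = 1

theorem tensorAct_diagEmbed {L L' K : ℕ} (X : Fin K → Matrix (Fin L') (Fin L) ℝ)
    (p : Fin L → ℝ) (y : Fin K → Fin L') :
    tensorAct X (diagEmbed p K) y = ∑ i, p i * ∏ k, X k (y k) i := by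
  simp only [tensorAct, diagEmbed, Finset.sum_mul]
  rw [Finset.sum_comm]
  refine Finset.sum_congr rfl fun i _ => ?_
  rw [Finset.sum_eq_single (fun _ => i)]
  · simp
  · intro x _ hx
    rw [if_neg (fun h => hx (funext h)), zero_mul]
  · simp

theorem isChannel_one {L : ℕ} : isChannel (1 : Matrix (Fin L) (Fin L) ℝ) := by
  refine ⟨fun i j => ?_, fun j => ?_⟩
  · rw [Matrix.one_apply]
    split_ifs <;> norm_num
  · simp [Matrix.one_apply]

/-- Every square matrix becomes invertible after adding a suitable arbitrarily small positive
multiple of the identity. -/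
theorem Matrix.exists_pos_isUnit_add_smul_one {n : Type*} [Fintype n] [DecidableEq n]
    (A : Matrix n n ℝ) {δ : ℝ} (hδ : 0 < δ) :
    ∃ s, 0 < s ∧ s ≤ δ ∧ IsUnit (A + s • (1 : Matrix n n ℝ)) := by
  obtain ⟨s, ⟨hs0, hsδ⟩, hs⟩ := (Set.Ioc_infinite hδ).exists_notMem_finset
    (-A).charpoly.roots.toFinset
  refine ⟨s, hs0, hsδ, ?_⟩
  rw [Multiset.mem_toFinset, Polynomial.mem_roots (Matrix.charpoly_monic _).ne_zero,
    Polynomial.IsRoot, Matrix.eval_charpoly, sub_neg_eq_add, add_comm] at hs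
  rw [Matrix.isUnit_iff_isUnit_det, isUnit_iff_ne_zero, Matrix.smul_one_eq_diagonal]
  exact hs

theorem sum_fin_two_arrow {α M : Type*} [Fintype α] [AddCommMonoid M] (f : (Fin 2 → α) → M) :
    ∑ y, f y = ∑ i, ∑ j, f ![i, j] := by
  rw [← Fintype.sum_prod_type', ← (finTwoArrowEquiv α).symm.sum_comp]
  rfl

/-- An invertible nonnegative matrix with total mass `1` and positive column sums is an output of
two invertible channels. -/
theorem exists_channels_of_isUnit {L : ℕ} {Q : Matrix (Fin L) (Fin L) ℝ}
    (hQ : ∀ i j, 0 ≤ Q i j) (hcol : ∀ j, 0 < ∑ i, Q i j) (hsum : ∑ i, ∑ j, Q i j = 1)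
    (hunit : IsUnit Q) :
    ∃ (p : Fin L → ℝ) (W : Fin 2 → Matrix (Fin L) (Fin L) ℝ),
      probPos p ∧ (∀ k, isChannel (W k) ∧ IsUnit (W k)) ∧
      ∀ y, tensorAct W (diagEmbed p 2) y = Q (y 0) (y 1) := by
  let p : Fin L → ℝ := fun j => ∑ i, Q i j
  refine ⟨p, ![Q * Matrix.diagonal p⁻¹, 1], ⟨hcol, ?_⟩, Fin.forall_fin_two.2
    ⟨⟨⟨fun i j => ?_, fun j => ?_⟩, ?_⟩, isChannel_one, isUnit_one⟩, fun y => ?_⟩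
  · rw [← hsum, Finset.sum_comm]
  · simpa using mul_nonneg (hQ i j) (inv_nonneg.2 (hcol j).le)
  · simp only [Matrix.cons_val_zero, Matrix.mul_diagonal, ← Finset.sum_mul]
    exact mul_inv_cancel₀ (hcol j).ne'
  · refine hunit.mul ((Matrix.isUnit_diagonal).2 (Pi.isUnit_iff.2 fun j => ?_))
    exact isUnit_iff_ne_zero.2 (inv_ne_zero (hcol j).ne')
  · have h := (hcol (y 1)).ne'
    simp only [tensorAct_diagEmbed, Fin.prod_univ_two, Matrix.cons_val_zero, Matrix.cons_val_one,
      Matrix.mul_diagonal, Matrix.one_apply, mul_ite, mul_one, mul_zero, Finset.sum_ite_eq,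
      Finset.mem_univ, if_true, Pi.inv_apply, p]
    field_simp

theorem FR_L_two_L_dense (L : ℕ) (hL : 1 ≤ L) (q : (Fin 2 → Fin L) → ℝ)
    (hq_nonneg : ∀ y, 0 ≤ q y) (hq_sum : ∑ y, q y = 1)
    (ε : ℝ) (hε : 0 < ε) :
    ∃ (p : Fin L → ℝ) (W : Fin 2 → Matrix (Fin L) (Fin L) ℝ),
      probPos p ∧ (∀ k, isChannel (W k) ∧ IsUnit (W k)) ∧
      ∑ y : Fin 2 → Fin L, |tensorAct W (diagEmbed p 2) y - q y| ≤ ε := by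
  have hL0 : (0 : ℝ) < L := by exact_mod_cast hL
  let A : Matrix (Fin L) (Fin L) ℝ := Matrix.of fun i j => q ![i, j]
  have hA : ∀ i j, 0 ≤ A i j := fun i j => hq_nonneg _
  have hAsum : ∑ i, ∑ j, A i j = 1 := by
    rw [← hq_sum, sum_fin_two_arrow]
    rfl
  obtain ⟨s, hs0, hs, hunit⟩ := A.exists_pos_isUnit_add_smul_one
    (δ := ε / (2 * L)) (by positivity)
  have hone : ∀ i j, (0 : ℝ) ≤ (1 : Matrix (Fin L) (Fin L) ℝ) i j := isChannel_one.1
  have honesum : ∑ i, ∑ j, (1 : Matrix (Fin L) (Fin L) ℝ) i j = L := by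
    simp [Matrix.one_apply]
  have hc : 0 < 1 + s * L := by positivity
  let Q : Matrix (Fin L) (Fin L) ℝ := (1 + s * L)⁻¹ • (A + s • (1 : Matrix (Fin L) (Fin L) ℝ))
  have hQ_apply : ∀ i j, Q i j =
      (1 + s * L)⁻¹ * (A i j + s * (1 : Matrix (Fin L) (Fin L) ℝ) i j) := fun i j => rfl
  obtain ⟨p, W, hp, hW, hout⟩ := exists_channels_of_isUnit (Q := Q)
    (fun i j => by
      rw [hQ_apply]
      have := hA i j
      have := hone i j
      positivity)
    (fun j => by
      simp only [hQ_apply, ← Finset.mul_sum, Finset.sum_add_distrib, isChannel_one.2 j]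
      have := Finset.sum_nonneg fun i (_ : i ∈ Finset.univ) => hA i j
      positivity)
    (by
      simp only [hQ_apply, ← Finset.mul_sum, Finset.sum_add_distrib, honesum, hAsum]
      exact inv_mul_cancel₀ hc.ne')
    (hunit.smul (Units.mk0 _ (inv_ne_zero hc.ne')))
  refine ⟨p, W, hp, hW, ?_⟩
  have hbound : ∀ i j, |Q i j - A i j| ≤
      s * (1 : Matrix (Fin L) (Fin L) ℝ) i j + s * L * A i j := by
    intro i j
    have h1 := mul_nonneg hs0.le (hone i j)
    have h2 : 0 ≤ s * L * A i j := mul_nonneg (by positivity) (hA i j)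
    have heq : Q i j - A i j = (s * (1 : Matrix (Fin L) (Fin L) ℝ) i j - s * L * A i j) /
        (1 + s * L) := by
      rw [hQ_apply]
      field_simp
      ring
    rw [heq, abs_div, abs_of_pos hc]
    refine (div_le_self (abs_nonneg _) (by nlinarith)).trans ?_
    rw [abs_le]
    constructor <;> linarith
  calc ∑ y : Fin 2 → Fin L, |tensorAct W (diagEmbed p 2) y - q y|
      = ∑ i, ∑ j, |Q i j - A i j| := by
        rw [sum_fin_two_arrow]
        simp only [hout]
        rfl
    _ ≤ ∑ i, ∑ j, (s * (1 : Matrix (Fin L) (Fin L) ℝ) i j + s * L * A i j) :=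
        Finset.sum_le_sum fun i _ => Finset.sum_le_sum fun j _ => hbound i j
    _ = s * (2 * L) := by
        simp only [Finset.sum_add_distrib, ← Finset.mul_sum, honesum, hAsum]
        ring
    _ ≤ ε := (le_div_iff₀ (by positivity)).1 hs
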